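/- Let H be a pseudovariety of finite groups and let H̄ denote the pseudovariety of finite monoids all of whose subgroups belong to H. Then for any finitely generated subgroup K of a free group F of finite rank and any automorphism φ of F: if the transition monoid M(K) of the Stallings automaton of K lies in H̄, then M(Kφ) lies in H̄. -/

import Mathlib

/-- Reading a word over `Ã = A × Bool` from a state of a partial deterministic automaton. -/
def readWord {Q A : Type} (δ : Q → A × Bool → Option Q) : Q → List (A × Bool) → Option Q
  | q, [] => some q
  | q, x :: w =>
    match δ q x with
    | none => none
    | some q' => readWord δ q' w

/-- The partial transformation `δ_w` as an element of `Function.End (Option Q)`. -/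
def ptrans {Q A : Type} (δ : Q → A × Bool → Option Q) (w : List (A × Bool)) :
    Function.End (Option Q) :=
  fun oq => oq.bind fun q => readWord δ q w

/-- Domain of the partial transformation `δ_w`. -/
def pdom {Q A : Type} (δ : Q → A × Bool → Option Q) (w : List (A × Bool)) : Set Q :=
  {q | (readWord δ q w).isSome}

/-- Image of the partial transformation `δ_w`. -/
def pim {Q A : Type} (δ : Q → A × Bool → Option Q) (w : List (A × Bool)) : Set Q :=
  {q | ∃ p, readWord δ p w = some q}

/-- "Every group `H`-class of the transition monoid of the automaton `δ` belongs to the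
pseudovariety `H`": group `H`-classes are the sets of `δ_v` with `dom δ_v = im δ_v`
equal to a fixed `dom δ_w = im δ_w`; such a class belongs to `H` when every abstract
group `G` faithfully representing it (via a multiplicative injection onto the class)
satisfies `H G`. -/
def TransMonoidSubgroupsIn {Q A : Type} (H : (G : Type) → [inst : Group G] → Prop)
    (δ : Q → A × Bool → Option Q) : Prop :=
  ∀ w : List (A × Bool), pdom δ w = pim δ w →
    ∀ (G : Type) [Group G] (f : G → Function.End (Option Q)),
      (∀ g h : G, f (g * h) = f g * f h) → Function.Injective f →
      Set.range f = {m | ∃ v, m = ptrans δ v ∧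
        pdom δ v = pdom δ w ∧ pim δ v = pdom δ w} →
      H G

section Automaton

variable {Q A : Type} {δ : Q → A × Bool → Option Q}

/-- A partial deterministic automaton over `A × Bool` is inverse when the letters `(a, b)` and
`(a, !b)` act as mutually inverse partial injections. -/
def IsInverseAutomaton (δ : Q → A × Bool → Option Q) : Prop :=
  ∀ (p q : Q) (a : A) (b : Bool), δ p (a, b) = some q ↔ δ q (a, !b) = some p

theorem readWord_cons (q : Q) (x : A × Bool) (w : List (A × Bool)) :
    readWord δ q (x :: w) = (δ q x).bind fun p => readWord δ p w := by
  rw [readWord]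
  cases δ q x <;> rfl

theorem readWord_append (q : Q) (v w : List (A × Bool)) :
    readWord δ q (v ++ w) = (readWord δ q v).bind fun p => readWord δ p w := by
  induction v generalizing q with
  | nil => rfl
  | cons x v ih => simp [readWord_cons, ih, Option.bind_assoc]

theorem readWord_append_eq_some {q p : Q} {v w : List (A × Bool)} :
    readWord δ q (v ++ w) = some p ↔
      ∃ r, readWord δ q v = some r ∧ readWord δ r w = some p := by
  rw [readWord_append, Option.bind_eq_some_iff]

theorem readWord_append_of_eq {q r p : Q} {v w : List (A × Bool)}
    (hv : readWord δ q v = some r) (hw : readWord δ r w = some p) :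
    readWord δ q (v ++ w) = some p :=
  readWord_append_eq_some.2 ⟨r, hv, hw⟩

namespace IsInverseAutomaton

theorem readWord_invRev (hδ : IsInverseAutomaton δ) {q p : Q} {w : List (A × Bool)}
    (h : readWord δ q w = some p) : readWord δ p (FreeGroup.invRev w) = some q := by
  induction w generalizing q with
  | nil => simpa [readWord, eq_comm] using h
  | cons x w ih =>
    rw [readWord_cons, Option.bind_eq_some_iff] at h
    obtain ⟨r, hr, h⟩ := h
    rw [FreeGroup.invRev_cons]
    refine readWord_append_of_eq (ih h) ?_
    have := (hδ q r x.1 x.2).1 hr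
    simp [FreeGroup.invRev, readWord, this]

theorem readWord_injective (hδ : IsInverseAutomaton δ) {q q' p : Q} {w : List (A × Bool)}
    (h : readWord δ q w = some p) (h' : readWord δ q' w = some p) : q = q' := by
  have := hδ.readWord_invRev h
  rw [hδ.readWord_invRev h'] at this
  exact (Option.some_injective _ this).symm

theorem readWord_step (hδ : IsInverseAutomaton δ) {q p : Q} {v w : List (A × Bool)}
    (hvw : FreeGroup.Red.Step v w) (h : readWord δ q v = some p) :
    readWord δ q w = some p := by
  obtain ⟨⟩ := hvw
  rename_i L₁ L₂ a b
  obtain ⟨r, h₁, h⟩ := readWord_append_eq_some.1 h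
  rw [readWord_cons, Option.bind_eq_some_iff] at h
  obtain ⟨s, hs, h⟩ := h
  rw [readWord_cons, (hδ r s a b).1 hs] at h
  exact readWord_append_of_eq h₁ h

theorem readWord_red (hδ : IsInverseAutomaton δ) {q p : Q} {v w : List (A × Bool)}
    (hvw : FreeGroup.Red v w) (h : readWord δ q v = some p) :
    readWord δ q w = some p := by
  induction hvw with
  | refl => exact h
  | tail _ hs ih => exact hδ.readWord_step hs ih

theorem readWord_toWord [DecidableEq A] (hδ : IsInverseAutomaton δ) {q p : Q}
    {w : List (A × Bool)} (h : readWord δ q w = some p) :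
    readWord δ q (FreeGroup.mk w).toWord = some p :=
  hδ.readWord_red FreeGroup.reduce.red h

theorem readWord_toWord_mul [DecidableEq A] (hδ : IsInverseAutomaton δ) {q r p : Q}
    {g h : FreeGroup A} (hg : readWord δ q g.toWord = some r)
    (hh : readWord δ r h.toWord = some p) :
    readWord δ q (g * h).toWord = some p := by
  have := hδ.readWord_toWord (readWord_append_of_eq hg hh)
  rwa [← FreeGroup.mul_mk, FreeGroup.mk_toWord, FreeGroup.mk_toWord] at this

theorem readWord_toWord_inv [DecidableEq A] (hδ : IsInverseAutomaton δ) {q p : Q}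
    {g : FreeGroup A} (hg : readWord δ q g.toWord = some p) :
    readWord δ p g⁻¹.toWord = some q := by
  rw [FreeGroup.toWord_inv]
  exact hδ.readWord_invRev hg

/-- The states of a connected inverse automaton recognising `K` at `q₀` are labelled by coset
representatives of `K`, and reduced words act on states as they act on cosets. -/
theorem exists_cosetRep [DecidableEq A] (hδ : IsInverseAutomaton δ) {q₀ : Q}
    {K : Subgroup (FreeGroup A)}
    (hconn : ∀ q : Q, ∃ w : List (A × Bool), readWord δ q₀ w = some q)
    (hlink : ∀ w : List (A × Bool), FreeGroup.reduce w = w →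
      (FreeGroup.mk w ∈ K ↔ readWord δ q₀ w = some q₀)) :
    ∃ u : Q → FreeGroup A, u q₀ ∈ K ∧
      ∀ q p g, u q * g * (u p)⁻¹ ∈ K ↔ readWord δ q g.toWord = some p := by
  have hK (g : FreeGroup A) : g ∈ K ↔ readWord δ q₀ g.toWord = some q₀ := by
    rw [← hlink _ (FreeGroup.reduce_toWord g), FreeGroup.mk_toWord]
  choose w hw using hconn
  have hu (q : Q) : readWord δ q₀ (FreeGroup.mk (w q)).toWord = some q :=
    hδ.readWord_toWord (hw q)
  refine ⟨fun q => FreeGroup.mk (w q), (hK _).2 (hu q₀), fun q p g => ?_⟩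
  rw [hK]
  refine ⟨fun h => ?_, fun h => hδ.readWord_toWord_mul (hδ.readWord_toWord_mul (hu q) h)
    (hδ.readWord_toWord_inv (hu p))⟩
  have := hδ.readWord_toWord_mul
    (hδ.readWord_toWord_mul (hδ.readWord_toWord_inv (hu q)) h) (hu p)
  group at this
  exact this

end IsInverseAutomaton

end Automaton

namespace FreeGroup

variable {α : Type*}

/-- Multiplying a reduced word on the left by a shorter word preserves a nonempty suffix. -/
theorem exists_isReduced_append_left (t x z : List (α × Bool)) (h : IsReduced (x ++ z))
    (ht : t.length < x.length) :
    ∃ t' x', x' <:+ x ∧ x.length ≤ x'.length + t.length ∧ mk (t ++ x) = mk (t' ++ x') ∧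
      IsReduced (t' ++ x' ++ z) := by
  classical
  induction t with
  | nil => exact ⟨[], x, List.suffix_refl x, by simp, rfl, by simpa using h⟩
  | cons b t ih =>
    simp only [List.length_cons] at ht
    obtain ⟨t', x', hx', hlen, hmk, hred⟩ := ih (by omega)
    have hcons (c : α × Bool) (l : List (α × Bool)) (hl : t' ++ x' = c :: l)
        (hc : b.1 = c.1 ∧ b.2 = !c.2) : mk (b :: t ++ x) = mk l := by
      have : mk (b :: t ++ x) = mk [b] * mk (t ++ x) := by simp
      rw [this, hmk, hl]
      obtain ⟨b₁, b₂⟩ := b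
      obtain ⟨c₁, c₂⟩ := c
      dsimp only at hc
      obtain ⟨rfl, rfl⟩ := hc
      rw [mul_mk]
      refine Quot.sound ?_
      exact (Red.Step.not_rev (L₁ := []) (L₂ := l) (x := b₁) (b := c₂))
    have hcons' : mk (b :: t ++ x) = mk (b :: (t' ++ x')) := by
      have : mk (b :: t ++ x) = mk [b] * mk (t ++ x) := by simp
      rw [this, hmk, mul_mk]
      rfl
    rcases t' with _ | ⟨c, t'⟩
    · rcases x' with _ | ⟨c, x'⟩
      · simp at hlen
        omega
      · by_cases hc : b.1 = c.1 ∧ b.2 = !c.2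
        · refine ⟨[], x', (List.suffix_cons c x').trans hx', ?_, hcons c x' rfl hc,
            List.IsChain.tail hred⟩
          simp only [List.length_cons] at hlen ⊢
          omega
        · refine ⟨[b], c :: x', hx', by simp only [List.length_cons] at hlen ⊢; omega,
            hcons', ?_⟩
          simp only [List.nil_append, List.cons_append, IsReduced,
            List.isChain_cons_cons] at hred ⊢
          exact ⟨by grind, hred⟩
    · by_cases hc : b.1 = c.1 ∧ b.2 = !c.2
      · refine ⟨t', x', hx', ?_, hcons c _ rfl hc, List.IsChain.tail hred⟩
        simp only [List.length_cons] at hlen ⊢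
        omega
      · refine ⟨b :: c :: t', x', hx', by simp only [List.length_cons] at hlen ⊢; omega,
          hcons', ?_⟩
        simp only [List.cons_append, IsReduced, List.isChain_cons_cons] at hred ⊢
        exact ⟨by grind, hred⟩

theorem IsReduced.invRev {w : List (α × Bool)} (h : IsReduced w) :
    IsReduced (FreeGroup.invRev w) := by
  classical
  rw [isReduced_iff_reduce_eq] at h ⊢
  rw [reduce_invRev, h]

/-- Multiplying a reduced word on the right by a shorter word preserves a nonempty initial segment. -/
theorem exists_isReduced_append_right (x z s : List (α × Bool)) (h : IsReduced (x ++ z))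
    (hs : s.length < z.length) :
    ∃ z' s', z' <+: z ∧ z' ≠ [] ∧ mk (z ++ s) = mk (z' ++ s') ∧
      IsReduced (x ++ z' ++ s') := by
  obtain ⟨s', z', hz', hlen, hmk, hred⟩ := exists_isReduced_append_left
    (invRev s) (invRev z) (invRev x) (by simpa [invRev_append] using h.invRev) (by simpa)
  refine ⟨invRev z', invRev s', ?_, ?_, ?_, ?_⟩
  · obtain ⟨r, hr⟩ := hz'
    exact ⟨invRev r, by rw [← invRev_append, hr, invRev_invRev]⟩
  · intro h0
    have := congrArg List.length h0
    simp only [invRev_length, List.length_nil] at this hlen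
    omega
  · have := congrArg (·⁻¹) hmk
    simpa [inv_mk, invRev_append] using this
  · simpa [invRev_append] using hred.invRev

variable [DecidableEq α]

theorem le_length_toWord_pow {g : FreeGroup α} (hg : g ≠ 1) (n : ℕ) :
    n ≤ (g ^ n).toWord.length := by
  rcases n with _ | n
  · simp
  · rw [toWord_pow, reduceCyclically.reduce_flatten_replicate_succ isReduced_toWord]
    have hne : reduceCyclically g.toWord ≠ [] := by
      intro h0
      have h := reduceCyclically.conj_conjugator_reduceCyclically g.toWord
      rw [h0, List.append_nil] at h
      apply hg
      rw [← mk_toWord (x := g), ← h, ← mul_mk, ← inv_mk, mul_inv_cancel]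
    have hpos := List.length_pos_iff.2 hne
    simp only [List.length_append, List.length_flatten, List.map_replicate, List.sum_replicate,
      smul_eq_mul]
    nlinarith

end FreeGroup

theorem IsInverseAutomaton.exists_forall_mul_mem {Q A ι : Type} [DecidableEq A] [Finite ι]
    {δ : Q → A × Bool → Option Q} (hδ : IsInverseAutomaton δ) {q₀ : Q}
    {K : Subgroup (FreeGroup A)} {u : Q → FreeGroup A} (hu₀ : u q₀ ∈ K)
    (hu : ∀ q p g, u q * g * (u p)⁻¹ ∈ K ↔ readWord δ q g.toWord = some p)
    (t : ι → FreeGroup A) {g : FreeGroup A} (hg : g ≠ 1)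
    (hgt : ∀ i, t i * g * (t i)⁻¹ ∈ K) :
    ∃ (x : FreeGroup A) (s : ι → Q), ∀ i, t i * x * (u (s i))⁻¹ ∈ K := by
  obtain ⟨L, hL⟩ : ∃ L, ∀ i, (t i).toWord.length ≤ L := by
    obtain ⟨L, hL⟩ := (Set.finite_range fun i => (t i).toWord.length).bddAbove
    exact ⟨L, fun i => hL ⟨i, rfl⟩⟩
  set W := (g ^ (2 * L + 2)).toWord with hW
  have hWlen : 2 * L + 2 ≤ W.length := FreeGroup.le_length_toWord_pow hg _
  have hWred : FreeGroup.IsReduced (W.take (L + 1) ++ W.drop (L + 1)) := by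
    rw [List.take_append_drop]
    exact FreeGroup.isReduced_toWord
  suffices ∀ i, ∃ s, t i * FreeGroup.mk (W.take (L + 1)) * (u s)⁻¹ ∈ K by
    choose s hs using this
    exact ⟨_, s, hs⟩
  intro i
  obtain ⟨t', x', hx', hlen, hmk, hred⟩ := FreeGroup.exists_isReduced_append_left
    (t i).toWord _ _ hWred (by simp only [List.length_take]; grind)
  obtain ⟨z', s', hz', hz₀, hmk', hred'⟩ := FreeGroup.exists_isReduced_append_right
    _ _ (FreeGroup.invRev (t i).toWord) hWred
    (by simp only [List.length_drop, FreeGroup.invRev_length]; grind)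
  have hfull : FreeGroup.IsReduced (t' ++ x' ++ z' ++ s') := by
    obtain ⟨y, hy⟩ := hx'
    obtain ⟨y', hy'⟩ := hz'
    have h₁ : FreeGroup.IsReduced (t' ++ x' ++ z') :=
      List.IsChain.left_of_append (l₂ := y')
        (by simpa [FreeGroup.IsReduced, ← hy'] using hred)
    have h₂ : FreeGroup.IsReduced (z' ++ s') :=
      List.IsChain.right_of_append (l₁ := W.take (L + 1))
        (by simpa [FreeGroup.IsReduced] using hred')
    exact h₁.append_overlap h₂ hz₀
  have hmem : FreeGroup.mk (t' ++ x' ++ z' ++ s') ∈ K := by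
    have h₁ : FreeGroup.mk (t' ++ x' ++ z' ++ s') = t i * g ^ (2 * L + 2) * (t i)⁻¹ := by
      rw [List.append_assoc, ← FreeGroup.mul_mk, ← hmk, ← hmk', FreeGroup.mul_mk,
        List.append_assoc, ← List.append_assoc (W.take _), List.take_append_drop,
        ← FreeGroup.mul_mk, ← FreeGroup.mul_mk, ← FreeGroup.inv_mk, FreeGroup.mk_toWord,
        FreeGroup.mk_toWord, mul_assoc]
    rw [h₁, ← conj_pow]
    exact pow_mem (hgt i) _
  have hread : readWord δ q₀ (t' ++ x' ++ z' ++ s') = some q₀ := by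
    have := (hu q₀ q₀ (FreeGroup.mk (t' ++ x' ++ z' ++ s'))).1
      (mul_mem (mul_mem hu₀ hmem) (inv_mem hu₀))
    rwa [FreeGroup.toWord_mk, hfull.reduce_eq] at this
  rw [List.append_assoc, readWord_append_eq_some] at hread
  obtain ⟨s, hs, -⟩ := hread
  refine ⟨s, ?_⟩
  have := (hu q₀ s _).2 (hδ.readWord_toWord hs)
  rw [← hmk, ← FreeGroup.mul_mk, FreeGroup.mk_toWord, mul_assoc] at this
  exact (Subgroup.mul_mem_cancel_left K hu₀).1 this

section PermGroup

variable {Q A : Type} {δ : Q → A × Bool → Option Q}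

/-- The permutations of a set of states `E` that are induced by words. -/
def IsInverseAutomaton.permGroup (hδ : IsInverseAutomaton δ) (E : Set Q) :
    Subgroup (Equiv.Perm E) where
  carrier := {σ | ∃ v, ∀ q : E, readWord δ q v = some (σ q : Q)}
  mul_mem' := by
    rintro σ τ ⟨v, hv⟩ ⟨w, hw⟩
    exact ⟨w ++ v, fun q => readWord_append_of_eq (hw q) (hv (τ q))⟩
  one_mem' := ⟨[], fun _ => rfl⟩
  inv_mem' := by
    rintro σ ⟨v, hv⟩
    refine ⟨FreeGroup.invRev v, fun q => hδ.readWord_invRev ?_⟩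
    simpa using hv (σ⁻¹ q)

theorem IsInverseAutomaton.mem_permGroup (hδ : IsInverseAutomaton δ) {E : Set Q}
    {σ : Equiv.Perm E} :
    σ ∈ hδ.permGroup E ↔ ∃ v, ∀ q : E, readWord δ q v = some (σ q : Q) :=
  Iff.rfl

open Classical in
/-- A permutation of `E`, viewed as a partial transformation with domain `E`. -/
noncomputable def permToEnd {E : Set Q} (σ : Equiv.Perm E) : Function.End (Option Q) :=
  fun oq => oq.bind fun q => if h : q ∈ E then some (σ ⟨q, h⟩ : Q) else none

theorem permToEnd_some {E : Set Q} (σ : Equiv.Perm E) (q : E) :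
    permToEnd σ (some (q : Q)) = some (σ q : Q) := by
  simp [permToEnd]

theorem permToEnd_mul {E : Set Q} (σ τ : Equiv.Perm E) :
    permToEnd (σ * τ) = permToEnd σ * permToEnd τ := by
  funext oq
  rcases oq with _ | q
  · rfl
  · change _ = permToEnd σ (permToEnd τ (some q))
    by_cases h : q ∈ E <;> simp [permToEnd, h]

theorem permToEnd_injective {E : Set Q} :
    Function.Injective (permToEnd : Equiv.Perm E → Function.End (Option Q)) := by
  intro σ τ h
  ext q
  have := congrFun h (some (q : Q))
  rwa [permToEnd_some, permToEnd_some, Option.some_inj] at this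

theorem mem_pdom {w : List (A × Bool)} {q : Q} :
    q ∈ pdom δ w ↔ ∃ p, readWord δ q w = some p :=
  Option.isSome_iff_exists

theorem ptrans_eq_permToEnd {E : Set Q} {σ : Equiv.Perm E} {v : List (A × Bool)}
    (hE : pdom δ v = E) (hv : ∀ q : E, readWord δ q v = some (σ q : Q)) :
    ptrans δ v = permToEnd σ := by
  funext oq
  rcases oq with _ | q
  · rfl
  · by_cases h : q ∈ E
    · exact (hv ⟨q, h⟩).trans (permToEnd_some σ ⟨q, h⟩).symm
    · have : readWord δ q v = none := by
        rw [Option.eq_none_iff_forall_ne_some]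
        intro p hp
        exact h (hE ▸ mem_pdom.2 ⟨p, hp⟩)
      simp [ptrans, permToEnd, h, this]

theorem pim_eq_of_perm {E : Set Q} {σ : Equiv.Perm E} {v : List (A × Bool)}
    (hE : pdom δ v = E) (hv : ∀ q : E, readWord δ q v = some (σ q : Q)) :
    pim δ v = E := by
  ext p
  constructor
  · rintro ⟨q, hq⟩
    have hqE : q ∈ E := hE ▸ mem_pdom.2 ⟨p, hq⟩
    have := hv ⟨q, hqE⟩
    simp only [hq, Option.some_inj] at this
    exact this ▸ (σ _).2
  · intro hp
    refine ⟨σ.symm ⟨p, hp⟩, ?_⟩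
    simpa using hv (σ.symm ⟨p, hp⟩)

namespace IsInverseAutomaton

theorem pdom_append_invRev (hδ : IsInverseAutomaton δ) (w : List (A × Bool)) :
    pdom δ (w ++ FreeGroup.invRev w) = pdom δ w := by
  ext q
  simp only [mem_pdom, readWord_append_eq_some]
  constructor
  · rintro ⟨p, r, hr, -⟩
    exact ⟨r, hr⟩
  · rintro ⟨r, hr⟩
    exact ⟨q, r, hr, hδ.readWord_invRev hr⟩

theorem readWord_append_invRev (hδ : IsInverseAutomaton δ) {w : List (A × Bool)} {q : Q}
    (hq : q ∈ pdom δ w) : readWord δ q (w ++ FreeGroup.invRev w) = some q := by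
  obtain ⟨r, hr⟩ := mem_pdom.1 hq
  exact readWord_append_of_eq hr (hδ.readWord_invRev hr)

theorem pim_append_invRev (hδ : IsInverseAutomaton δ) (w : List (A × Bool)) :
    pim δ (w ++ FreeGroup.invRev w) = pdom δ w :=
  pim_eq_of_perm (σ := 1) (hδ.pdom_append_invRev w) fun q => hδ.readWord_append_invRev q.2

/-- The group `H`-class of the idempotent with domain `pdom δ w` consists of the permutations of
that domain induced by words. -/
theorem range_permToEnd [Finite Q] (hδ : IsInverseAutomaton δ) (w : List (A × Bool)) :
    Set.range (fun σ : hδ.permGroup (pdom δ w) => permToEnd σ.1) =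
      {m | ∃ v, m = ptrans δ v ∧ pdom δ v = pdom δ w ∧ pim δ v = pdom δ w} := by
  ext m
  constructor
  · rintro ⟨⟨σ, v, hv⟩, rfl⟩
    have hread (q : pdom δ w) :
        readWord δ q (w ++ FreeGroup.invRev w ++ v) = some (σ q : Q) :=
      readWord_append_of_eq (hδ.readWord_append_invRev q.2) (hv q)
    have hdom : pdom δ (w ++ FreeGroup.invRev w ++ v) = pdom δ w := by
      ext q
      constructor
      · intro hq
        obtain ⟨p, hp⟩ := mem_pdom.1 hq
        rw [List.append_assoc] at hp
        obtain ⟨r, hr, -⟩ := readWord_append_eq_some.1 hp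
        exact mem_pdom.2 ⟨r, hr⟩
      · exact fun hq => mem_pdom.2 ⟨_, hread ⟨q, hq⟩⟩
    exact ⟨_, (ptrans_eq_permToEnd hdom hread).symm, hdom, pim_eq_of_perm hdom hread⟩
  · rintro ⟨v, rfl, hdom, him⟩
    have hex (q : pdom δ w) : ∃ p : pdom δ w, readWord δ q v = some (p : Q) := by
      obtain ⟨p, hp⟩ := mem_pdom.1 (hdom.symm ▸ q.2 : (q : Q) ∈ pdom δ v)
      exact ⟨⟨p, him ▸ ⟨q, hp⟩⟩, hp⟩
    choose f hf using hex
    have hinj : Function.Injective f := fun q q' h =>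
      Subtype.ext (hδ.readWord_injective (hf q) (h ▸ hf q'))
    let σ : Equiv.Perm (pdom δ w) :=
      Equiv.ofBijective f (Finite.injective_iff_bijective.1 hinj)
    exact ⟨⟨σ, v, hf⟩, (ptrans_eq_permToEnd (σ := σ) hdom hf).symm⟩

end IsInverseAutomaton

end PermGroup

theorem nonempty_mulEquiv_of_range_eq {G G' M : Type*} [Mul G] [Mul G'] [Mul M]
    {f : G → M} {f' : G' → M} (hf : ∀ a b, f (a * b) = f a * f b)
    (hf' : ∀ a b, f' (a * b) = f' a * f' b) (hinj : Function.Injective f)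
    (hinj' : Function.Injective f') (h : Set.range f = Set.range f') :
    Nonempty (G ≃* G') := by
  have hex (a : G) : ∃ b, f' b = f a := by
    have : f a ∈ Set.range f' := h ▸ ⟨a, rfl⟩
    exact this
  choose e he using hex
  refine ⟨MulEquiv.ofBijective (⟨e, fun a b => hinj' ?_⟩ : G →ₙ* G') ⟨?_, ?_⟩⟩
  · rw [hf', he, he, he, hf]
  · intro a b hab
    apply hinj
    rw [← he, ← he]
    exact congrArg f' hab
  · intro b
    have : f' b ∈ Set.range f := h ▸ ⟨b, rfl⟩
    obtain ⟨a, ha⟩ := this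
    exact ⟨a, hinj' ((he a).trans ha)⟩

theorem transMonoidSubgroupsIn_iff {Q A : Type} [Finite Q] {δ : Q → A × Bool → Option Q}
    (hδ : IsInverseAutomaton δ) {H : (G : Type) → [Group G] → Prop}
    (hIso : ∀ (G G' : Type) [Group G] [Group G'], (G ≃* G') → H G → H G') :
    TransMonoidSubgroupsIn H δ ↔ ∀ w, H (hδ.permGroup (pdom δ w)) := by
  have hmul (w : List (A × Bool)) (σ τ : hδ.permGroup (pdom δ w)) :
      permToEnd (σ * τ).1 = permToEnd σ.1 * permToEnd τ.1 := permToEnd_mul _ _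
  have hinj (w : List (A × Bool)) :
      Function.Injective fun σ : hδ.permGroup (pdom δ w) => permToEnd σ.1 :=
    permToEnd_injective.comp Subtype.val_injective
  constructor
  · intro h w
    refine h (w ++ FreeGroup.invRev w)
      ((hδ.pdom_append_invRev w).trans (hδ.pim_append_invRev w).symm) _
      (fun σ => permToEnd σ.1) (hmul w) (hinj w) ?_
    rw [hδ.pdom_append_invRev]
    exact hδ.range_permToEnd w
  · intro h w _ G _ f hf hfinj hrange
    obtain ⟨e⟩ := nonempty_mulEquiv_of_range_eq (hmul w) hf (hinj w) hfinj
      ((hδ.range_permToEnd w).trans hrange.symm)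
    exact hIso _ _ e (h w)

/-- A class of groups closed under subgroups and quotients is closed under division, where a
division is presented by a subgroup of the product. -/
theorem of_division {H : (G : Type) → [Group G] → Prop}
    (hIso : ∀ (G G' : Type) [Group G] [Group G'], (G ≃* G') → H G → H G')
    (hSub : ∀ (G : Type) [Group G] (S : Subgroup G), H G → H S)
    (hQuot : ∀ (G G' : Type) [Group G] [Group G'] (f : G →* G'),
      Function.Surjective f → H G → H G')
    {G G' : Type} [Group G] [Group G'] (R : Subgroup (G × G'))
    (hfun : ∀ τ : G', ((1 : G), τ) ∈ R → τ = 1) (hsurj : ∀ τ : G', ∃ σ : G, (σ, τ) ∈ R)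
    (hG : H G) : H G' := by
  let f : R →* G := (MonoidHom.fst G G').comp R.subtype
  have hf : Function.Injective f := by
    rw [injective_iff_map_eq_one]
    rintro ⟨⟨σ, τ⟩, hR⟩ h
    obtain rfl : σ = 1 := h
    obtain rfl := hfun τ hR
    rfl
  refine hQuot R G' ((MonoidHom.snd G G').comp R.subtype) (fun τ => ?_)
    (hIso _ _ (MonoidHom.ofInjective hf).symm (hSub G f.range hG))
  obtain ⟨σ, h⟩ := hsurj τ
  exact ⟨⟨_, h⟩, rfl⟩

/-- In a finite inverse automaton, every set of states is contained in a domain `pdom δ w`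
that is permuted by every word permuting the given set. -/
theorem IsInverseAutomaton.exists_pdom_invariant {Q A : Type} [Finite Q]
    {δ : Q → A × Bool → Option Q} (hδ : IsInverseAutomaton δ) (S : Set Q) :
    ∃ w, S ⊆ pdom δ w ∧ ∀ v, (∀ q ∈ S, ∃ p ∈ S, readWord δ q v = some p) →
      ∃ σ ∈ hδ.permGroup (pdom δ w), ∀ q : pdom δ w, readWord δ q v = some (σ q : Q) := by
  obtain ⟨E, ⟨⟨w, rfl⟩, hS⟩, hmin⟩ :=
    (Set.toFinite {E : Set Q | (∃ w, pdom δ w = E) ∧ S ⊆ E}).exists_minimal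
      ⟨Set.univ, ⟨[], Set.eq_univ_of_forall fun q => mem_pdom.2 ⟨q, rfl⟩⟩, Set.subset_univ S⟩
  refine ⟨w, hS, fun v hv => ?_⟩
  have hsub : pdom δ (w ++ FreeGroup.invRev w ++ (v ++ w)) ⊆ pdom δ w := by
    intro q hq
    obtain ⟨p, hp⟩ := mem_pdom.1 hq
    rw [List.append_assoc] at hp
    obtain ⟨r, hr, -⟩ := readWord_append_eq_some.1 hp
    exact mem_pdom.2 ⟨r, hr⟩
  have hle : pdom δ w ⊆ pdom δ (w ++ FreeGroup.invRev w ++ (v ++ w)) := by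
    refine hmin ⟨⟨_, rfl⟩, fun q hq => ?_⟩ hsub
    obtain ⟨p, hpS, hp⟩ := hv q hq
    obtain ⟨r, hr⟩ := mem_pdom.1 (hS hpS)
    exact mem_pdom.2 ⟨r, readWord_append_of_eq (hδ.readWord_append_invRev (hS hq))
      (readWord_append_of_eq hp hr)⟩
  have hex (q : pdom δ w) : ∃ p : pdom δ w, readWord δ q v = some (p : Q) := by
    obtain ⟨r, hr⟩ := mem_pdom.1 (hle q.2)
    rw [readWord_append, hδ.readWord_append_invRev q.2, Option.bind_some] at hr
    obtain ⟨p, hp, hpr⟩ := readWord_append_eq_some.1 hr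
    exact ⟨⟨p, mem_pdom.2 ⟨r, hpr⟩⟩, hp⟩
  choose f hf using hex
  have hinj : Function.Injective f := fun q q' h =>
    Subtype.ext (hδ.readWord_injective (hf q) (h ▸ hf q'))
  exact ⟨Equiv.ofBijective f (Finite.injective_iff_bijective.1 hinj), ⟨v, hf⟩, hf⟩

/-- If the coset action underlying `δ'` is carried to that underlying `δ` by an automorphism of the
free group, then every group of permutations induced by words on a domain of `δ'` divides such a
group for `δ`. -/
theorem permGroup_of_mulEquiv {Q Q' A : Type} [DecidableEq A] [Finite Q] [Finite Q']
    {H : (G : Type) → [Group G] → Prop}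
    (hIso : ∀ (G G' : Type) [Group G] [Group G'], (G ≃* G') → H G → H G')
    (hSub : ∀ (G : Type) [Group G] (S : Subgroup G), H G → H S)
    (hQuot : ∀ (G G' : Type) [Group G] [Group G'] (f : G →* G'),
      Function.Surjective f → H G → H G')
    {K : Subgroup (FreeGroup A)} (φ : FreeGroup A ≃* FreeGroup A)
    {δ : Q → A × Bool → Option Q} (hδ : IsInverseAutomaton δ) {q₀ : Q}
    {δ' : Q' → A × Bool → Option Q'} (hδ' : IsInverseAutomaton δ')
    {u : Q → FreeGroup A} (hu₀ : u q₀ ∈ K)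
    (hu : ∀ q p g, u q * g * (u p)⁻¹ ∈ K ↔ readWord δ q g.toWord = some p)
    {u' : Q' → FreeGroup A}
    (hu' : ∀ q p g, u' q * g * (u' p)⁻¹ ∈ K.map φ.toMonoidHom ↔
      readWord δ' q g.toWord = some p)
    (h : ∀ w, H (hδ.permGroup (pdom δ w))) (w : List (A × Bool)) :
    H (hδ'.permGroup (pdom δ' w)) := by
  rcases subsingleton_or_nontrivial (hδ'.permGroup (pdom δ' w)) with htriv | hnontriv
  · exact hQuot _ _ (1 : hδ.permGroup (pdom δ []) →* _)
      (fun τ => ⟨1, Subsingleton.elim _ _⟩) (h [])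
  obtain ⟨τ, hτ⟩ := exists_ne (1 : hδ'.permGroup (pdom δ' w))
  obtain ⟨v, hv⟩ := hδ'.mem_permGroup.1 τ.2
  have hkey (g : FreeGroup A) (q p : Q') : φ.symm (u' q) * φ.symm g * (φ.symm (u' p))⁻¹ ∈ K ↔
      readWord δ' q g.toWord = some p := by
    rw [← hu', Subgroup.mem_map_equiv]
    simp
  have hpow (n : ℕ) (q : pdom δ' w) :
      readWord δ' q (FreeGroup.mk v ^ n).toWord = some ((τ ^ n).1 q : Q') := by
    induction n with
    | zero => simp [readWord]
    | succ n ih =>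
      rw [pow_succ, pow_succ']
      exact hδ'.readWord_toWord_mul ih (hδ'.readWord_toWord (hv ((τ ^ n).1 q)))
  have hv₁ : FreeGroup.mk v ≠ 1 := by
    intro h₁
    apply hτ
    ext q
    have := hδ'.readWord_toWord (hv q)
    rw [h₁, FreeGroup.toWord_one, readWord, Option.some_inj] at this
    exact this.symm
  obtain ⟨x, s, hs⟩ := hδ.exists_forall_mul_mem hu₀ hu
    (fun q : pdom δ' w => φ.symm (u' q)) (g := φ.symm (FreeGroup.mk v ^ orderOf τ))
    (by
      rw [Ne, EmbeddingLike.map_eq_one_iff, pow_eq_one_iff_left (orderOf_pos τ).ne']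
      exact hv₁)
    (fun q => (hkey _ _ _).2 (by rw [hpow, pow_orderOf_eq_one]; rfl))
  have hsinj : Function.Injective s := by
    intro i j hij
    have hj := hs j
    rw [← hij] at hj
    have := mul_mem (hs i) (inv_mem hj)
    have := (hkey 1 i j).1 (by simpa [mul_assoc] using this)
    rw [FreeGroup.toWord_one, readWord, Option.some_inj] at this
    exact Subtype.ext this
  have hconj {τ : Equiv.Perm (pdom δ' w)} {v : List (A × Bool)}
      (hv : ∀ q : pdom δ' w, readWord δ' q v = some (τ q : Q')) (q : pdom δ' w) :
      readWord δ (s q) (x⁻¹ * φ.symm (FreeGroup.mk v) * x).toWord = some (s (τ q)) := by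
    rw [← hu]
    have := mul_mem (mul_mem (inv_mem (hs q)) ((hkey _ _ _).2 (hδ'.readWord_toWord (hv q))))
      (hs (τ q))
    simpa [mul_assoc] using this
  obtain ⟨e, hS, he⟩ := hδ.exists_pdom_invariant (Set.range s)
  let R : Subgroup (hδ.permGroup (pdom δ e) × hδ'.permGroup (pdom δ' w)) :=
    { carrier := {r | ∀ q, r.1.1 ⟨s q, hS ⟨q, rfl⟩⟩ = ⟨s (r.2.1 q), hS ⟨_, rfl⟩⟩}
      mul_mem' := by
        intro a b ha hb q
        simp only [Set.mem_ofPred_eq] at ha hb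
        simp [ha, hb]
      one_mem' := fun q => rfl
      inv_mem' := by
        intro a ha q
        have := ha (a.2.1⁻¹ q)
        simp only [Equiv.Perm.inv_def, Equiv.apply_symm_apply] at this
        exact (Equiv.symm_apply_eq a.1.1).2 this.symm }
  refine of_division hIso hSub hQuot R (fun τ hR => ?_) (fun τ => ?_) (h e)
  · ext q
    have := congrArg Subtype.val (hR q)
    exact congrArg Subtype.val (hsinj this).symm
  · obtain ⟨v, hv⟩ := hδ'.mem_permGroup.1 τ.2
    obtain ⟨σ, hσ, hσv⟩ := he (x⁻¹ * φ.symm (FreeGroup.mk v) * x).toWord (by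
      rintro _ ⟨q, rfl⟩
      exact ⟨_, ⟨_, rfl⟩, hconj hv q⟩)
    refine ⟨⟨σ, hσ⟩, fun q => Subtype.ext ?_⟩
    have := hσv ⟨s q, hS ⟨q, rfl⟩⟩
    rw [hconj hv q, Option.some_inj] at this
    exact this.symm

/-- Let `H` be a pseudovariety of finite groups and `H̄` the pseudovariety
of finite monoids whose subgroups (group `H`-classes) all lie in `H`. If `K ≤ F_A` is
finitely generated with Stallings automaton `(Q, δ, q₀)`, `φ` is an automorphism of
`F_A`, and `(Q', δ', q₀')` is the Stallings automaton of `Kφ`, then `M(K) ∈ H̄` implies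
`M(Kφ) ∈ H̄`. -/
theorem stmt_13 {A : Type} [DecidableEq A]
    (H : (G : Type) → [inst : Group G] → Prop)
    (hIso : ∀ (G G' : Type) [Group G] [Group G'], (G ≃* G') → H G → H G')
    (hSub : ∀ (G : Type) [Group G] (S : Subgroup G), H G → H S)
    (hQuot : ∀ (G G' : Type) [Group G] [Group G'] (f : G →* G'),
      Function.Surjective f → H G → H G')
    (hProd : ∀ (G G' : Type) [Group G] [Group G'], H G → H G' → H (G × G'))
    (hFin : ∀ (G : Type) [Group G], H G → Finite G)
    (K : Subgroup (FreeGroup A)) (φ : FreeGroup A ≃* FreeGroup A)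
    {Q Q' : Type} [Fintype Q] [Fintype Q']
    (δ : Q → A × Bool → Option Q) (q₀ : Q)
    (δ' : Q' → A × Bool → Option Q') (q₀' : Q')
    -- (Q, δ, q₀) is the Stallings automaton of K:
    (hinv : ∀ (p q : Q) (a : A) (b : Bool), δ p (a, b) = some q ↔ δ q (a, !b) = some p)
    (hconn : ∀ q : Q, ∃ w : List (A × Bool), readWord δ q₀ w = some q)
    (hdeg : ∀ q : Q, q ≠ q₀ → 2 ≤ {x : A × Bool | (δ q x).isSome}.ncard)
    (hlink : ∀ w : List (A × Bool), FreeGroup.reduce w = w →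
      (FreeGroup.mk w ∈ K ↔ readWord δ q₀ w = some q₀))
    -- (Q', δ', q₀') is the Stallings automaton of Kφ:
    (hinv' : ∀ (p q : Q') (a : A) (b : Bool), δ' p (a, b) = some q ↔ δ' q (a, !b) = some p)
    (hconn' : ∀ q : Q', ∃ w : List (A × Bool), readWord δ' q₀' w = some q)
    (hdeg' : ∀ q : Q', q ≠ q₀' → 2 ≤ {x : A × Bool | (δ' q x).isSome}.ncard)
    (hlink' : ∀ w : List (A × Bool), FreeGroup.reduce w = w →
      (FreeGroup.mk w ∈ K.map φ.toMonoidHom ↔ readWord δ' q₀' w = some q₀')) :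
    TransMonoidSubgroupsIn H δ → TransMonoidSubgroupsIn H δ' := by
  have hδ : IsInverseAutomaton δ := hinv
  have hδ' : IsInverseAutomaton δ' := hinv'
  rw [transMonoidSubgroupsIn_iff hδ hIso, transMonoidSubgroupsIn_iff hδ' hIso]
  obtain ⟨u, hu₀, hu⟩ := hδ.exists_cosetRep hconn hlink
  obtain ⟨u', -, hu'⟩ := hδ'.exists_cosetRep hconn' hlink'
  exact permGroup_of_mulEquiv hIso hSub hQuot φ hδ hδ' hu₀ hu hu'
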